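/- Let Z = [[1,0],[0,−1]] and X = [[0,1],[1,0]] be the 2×2 Pauli matrices over ℂ, I the 2×2 identity matrix, I₈ the 8×8 identity matrix, and |GHZ⟩ = (e₀⊗e₀⊗e₀ + e₁⊗e₁⊗e₁)/√2 ∈ ℂ⁸. Define observables A₀ = Z, A₁ = X, B₀ = (X+Z)/√2, B₁ = (Z−X)/√2, C₀ = Z, C₁ = X, and for an observable O and outcome a ∈ {0,1} the projector Π_a(O) := (I + (−1)^a O)/2. For θ ∈ [0,1] let ρ_θ := θ·|GHZ⟩⟨GHZ| + (1−θ)·I₈/8, and define the behaviour P^θ(abc|xyz) := Tr[ρ_θ·(Π_a(A_x) ⊗ Π_b(B_y) ⊗ Π_c(C_z))] (a real number). Then W₁(P^θ) = (2 + 2√2)·θ; consequently P^θ violates the witness inequality W₁(P) ≤ 4 if and only if θ > 2/(√2 + 1). -/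

import Mathlib

open Matrix Kronecker Finset

/-- Pauli `Z` matrix. -/
noncomputable def pauliZ : Matrix (Fin 2) (Fin 2) ℂ := !![1, 0; 0, -1]

/-- Pauli `X` matrix. -/
noncomputable def pauliX : Matrix (Fin 2) (Fin 2) ℂ := !![0, 1; 1, 0]

/-- Measurement observables of party `A`: `A₀ = Z`, `A₁ = X`. -/
noncomputable def obsA : Fin 2 → Matrix (Fin 2) (Fin 2) ℂ := ![pauliZ, pauliX]

/-- Measurement observables of party `B`: `B₀ = (X+Z)/√2`, `B₁ = (Z−X)/√2`. -/
noncomputable def obsB : Fin 2 → Matrix (Fin 2) (Fin 2) ℂ :=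
  ![((Real.sqrt 2 : ℂ))⁻¹ • (pauliX + pauliZ), ((Real.sqrt 2 : ℂ))⁻¹ • (pauliZ - pauliX)]

/-- Measurement observables of party `C`: `C₀ = Z`, `C₁ = X`. -/
noncomputable def obsC : Fin 2 → Matrix (Fin 2) (Fin 2) ℂ := ![pauliZ, pauliX]

/-- Projector onto the outcome `a ∈ {0,1}` of a binary observable `O`:
`Π_a(O) = (I + (−1)^a O)/2`. -/
noncomputable def outProj (a : Fin 2) (O : Matrix (Fin 2) (Fin 2) ℂ) :
    Matrix (Fin 2) (Fin 2) ℂ :=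
  (2 : ℂ)⁻¹ • ((1 : Matrix (Fin 2) (Fin 2) ℂ) + ((-1 : ℂ) ^ (a : ℕ)) • O)

/-- Standard basis vector `e_i` of `ℂ²`. -/
def stdVec (i : Fin 2) : Fin 2 → ℂ := fun j => if j = i then 1 else 0

/-- Kronecker product of vectors. -/
def vkron {α β : Type*} (u : α → ℂ) (v : β → ℂ) : α × β → ℂ := fun p => u p.1 * v p.2

/-- The GHZ state `(e₀⊗e₀⊗e₀ + e₁⊗e₁⊗e₁)/√2` as a vector of `ℂ⁸`. -/
noncomputable def ghz : (Fin 2 × Fin 2) × Fin 2 → ℂ :=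
  ((Real.sqrt 2 : ℂ))⁻¹ •
    (vkron (vkron (stdVec 0) (stdVec 0)) (stdVec 0) +
      vkron (vkron (stdVec 1) (stdVec 1)) (stdVec 1))

/-- The depolarised GHZ state `ρ_θ = θ|GHZ⟩⟨GHZ| + (1−θ)I₈/8`. -/
noncomputable def rho (θ : ℝ) : Matrix ((Fin 2 × Fin 2) × Fin 2) ((Fin 2 × Fin 2) × Fin 2) ℂ :=
  (θ : ℂ) • vecMulVec ghz (star ghz) +
    (((1 - θ) / 8 : ℝ) : ℂ) • (1 : Matrix ((Fin 2 × Fin 2) × Fin 2) ((Fin 2 × Fin 2) × Fin 2) ℂ)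

/-- The behaviour obtained by measuring `ρ_θ` with the protocol's observables. -/
noncomputable def Pquantum (θ : ℝ) (a b c x y z : Fin 2) : ℝ :=
  ((rho θ * ((outProj a (obsA x) ⊗ₖ outProj b (obsB y)) ⊗ₖ outProj c (obsC z))).trace).re

/-- Two-party marginal correlator `M_AB^{xy}`. -/
noncomputable def corrAB (P : Fin 2 → Fin 2 → Fin 2 → Fin 2 → Fin 2 → Fin 2 → ℝ) (x y : Fin 2) : ℝ :=
  ∑ a : Fin 2, ∑ b : Fin 2, ∑ c : Fin 2, (-1 : ℝ) ^ ((a + b : Fin 2) : ℕ) * P a b c x y 0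

/-- Two-party marginal correlator `M_AC^{xz}`. -/
noncomputable def corrAC (P : Fin 2 → Fin 2 → Fin 2 → Fin 2 → Fin 2 → Fin 2 → ℝ) (x z : Fin 2) : ℝ :=
  ∑ a : Fin 2, ∑ b : Fin 2, ∑ c : Fin 2, (-1 : ℝ) ^ ((a + c : Fin 2) : ℕ) * P a b c x 0 z

/-- Full correlator `C^{xyz}`. -/
noncomputable def corrABC (P : Fin 2 → Fin 2 → Fin 2 → Fin 2 → Fin 2 → Fin 2 → ℝ) (x y z : Fin 2) : ℝ :=
  ∑ a : Fin 2, ∑ b : Fin 2, ∑ c : Fin 2, (-1 : ℝ) ^ ((a + b + c : Fin 2) : ℕ) * P a b c x y z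

/-- The witness value `W₁(P)` of Eq. (1) of the paper. -/
noncomputable def W1 (P : Fin 2 → Fin 2 → Fin 2 → Fin 2 → Fin 2 → Fin 2 → ℝ) : ℝ :=
  corrAB P 0 0 + corrAB P 0 1 + corrABC P 1 0 1 - corrABC P 1 1 1 + 2 * corrAC P 0 0

/-- Expectation value of a product operator in the depolarised GHZ state. -/
theorem trace_rho_mul_kronecker (θ : ℝ) (A B C : Matrix (Fin 2) (Fin 2) ℂ) :
    (rho θ * ((A ⊗ₖ B) ⊗ₖ C)).trace =
      (θ : ℂ) / 2 * ∑ i, ∑ j, A i j * B i j * C i j +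
        (1 - (θ : ℂ)) / 8 * (A.trace * B.trace * C.trace) := by
  have h : ((Real.sqrt 2 : ℂ))⁻¹ * ((Real.sqrt 2 : ℂ))⁻¹ = 1 / 2 := by
    rw [← mul_inv, ← Complex.ofReal_mul, Real.mul_self_sqrt zero_le_two]
    norm_num
  have hghz : (vecMulVec ghz (star ghz) * ((A ⊗ₖ B) ⊗ₖ C)).trace =
      1 / 2 * ∑ i, ∑ j, A i j * B i j * C i j := by
    rw [← h]
    simp [trace, mul_apply, vecMulVec_apply, ghz, vkron, stdVec, Fintype.sum_prod_type,
      Fin.sum_univ_two]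
    ring
  rw [rho, add_mul, trace_add, smul_mul, smul_mul, trace_smul, trace_smul, hghz, one_mul,
    trace_kronecker, trace_kronecker]
  push_cast
  simp only [smul_eq_mul]
  ring

theorem corrABC_Pquantum (θ : ℝ) (x y z : Fin 2) :
    corrABC (Pquantum θ) x y z =
      (rho θ * ((obsA x ⊗ₖ obsB y) ⊗ₖ obsC z)).trace.re := by
  simp only [corrABC, Pquantum, trace_rho_mul_kronecker]
  simp [outProj, Fin.sum_univ_two, trace, Matrix.one_apply]
  ring

theorem corrAB_Pquantum (θ : ℝ) (x y : Fin 2) :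
    corrAB (Pquantum θ) x y = (rho θ * ((obsA x ⊗ₖ obsB y) ⊗ₖ 1)).trace.re := by
  simp only [corrAB, Pquantum, trace_rho_mul_kronecker]
  simp [outProj, Fin.sum_univ_two, trace, Matrix.one_apply]
  ring

theorem corrAC_Pquantum (θ : ℝ) (x z : Fin 2) :
    corrAC (Pquantum θ) x z = (rho θ * ((obsA x ⊗ₖ 1) ⊗ₖ obsC z)).trace.re := by
  simp only [corrAC, Pquantum, trace_rho_mul_kronecker]
  simp [outProj, Fin.sum_univ_two, trace, Matrix.one_apply]
  ring

theorem W1_Pquantum (θ : ℝ) : W1 (Pquantum θ) = (2 + 2 * Real.sqrt 2) * θ := by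
  have h : (Real.sqrt 2)⁻¹ = Real.sqrt 2 / 2 := by
    rw [inv_eq_one_div, Real.sqrt_div_self'.symm]
  rw [W1, corrAB_Pquantum, corrAB_Pquantum, corrABC_Pquantum, corrABC_Pquantum, corrAC_Pquantum]
  simp only [trace_rho_mul_kronecker]
  simp [obsA, obsB, obsC, pauliX, pauliZ, Fin.sum_univ_two, trace, ← Complex.ofReal_inv, h]
  ring

/-- Measuring the depolarised GHZ state with the protocol for witness (1) yields a
behaviour with witness value `(2 + 2√2)θ`, which violates `W₁(P) ≤ 4` iff
`θ > 2/(√2 + 1)`. -/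
theorem W1_depolarised_ghz_quantum (θ : ℝ) (hθ0 : 0 ≤ θ) (hθ1 : θ ≤ 1) :
    W1 (Pquantum θ) = (2 + 2 * Real.sqrt 2) * θ ∧
      (4 < W1 (Pquantum θ) ↔ 2 / (Real.sqrt 2 + 1) < θ) := by
  have hpos : 0 < Real.sqrt 2 + 1 := by positivity
  refine ⟨W1_Pquantum θ, ?_⟩
  rw [W1_Pquantum, div_lt_iff₀ hpos]
  constructor <;> intro h <;> linarith
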